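/- arXiv:0911.3437 — 4 statements merged into one kernel-verified Lean document; each statement's English description precedes it below -/
import Mathlib

section
/- (Necessity of the global testing condition.) Let 1 < p ≤ q < ∞, let τ = (τ_Q)_{Q∈𝒬} be nonnegative constants, and let σ, ω be weights on ℝ^d. Suppose there is 𝔑 < ∞ such that ω({x : T_τ(fσ)(x) > λ}) ≤ (𝔑 ‖f‖_{L^p(σ)} / λ)^q for all λ > 0 and all nonnegative f ∈ L^p(σ). Then for every dyadic cube R with ω(R) > 0, ‖T^out_{τ,R}(1_R ω)‖_{L^{p'}(σ)} ≤ C(p,q) · 𝔑 · ω(R)^{1/q'}, where p' = p/(p−1), q' = q/(q−1). -/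
open MeasureTheory ENNReal

noncomputable section

/-- Index set for dyadic cubes of `ℝ^d`: a scale `k : ℤ` and a position `n ∈ ℤ^d`. -/
abbrev DIdx (d : ℕ) : Type := ℤ × (Fin d → ℤ)

/-- The dyadic cube `∏_j [2^k n_j, 2^k (n_j + 1))` of `ℝ^d`. -/
def dcube {d : ℕ} (i : DIdx d) : Set (Fin d → ℝ) :=
  {x | ∀ j, x j ∈ Set.Ico ((2 : ℝ) ^ i.1 * (i.2 j : ℝ)) ((2 : ℝ) ^ i.1 * ((i.2 j : ℝ) + 1))}

/-- The dyadic parent of a dyadic cube: the minimal dyadic cube strictly containing it. -/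
def dparent {d : ℕ} (i : DIdx d) : DIdx d :=
  (i.1 + 1, fun j => Int.fdiv (i.2 j) 2)

/-- The measure `ω dx` on `ℝ^d` associated with a weight `ω`. -/
def wMeasure {d : ℕ} (ω : (Fin d → ℝ) → ℝ≥0∞) : Measure (Fin d → ℝ) :=
  volume.withDensity ω

/-- The average of a nonnegative function `f` over the dyadic cube indexed by `i`,
with respect to the measure `μ`. -/
def cavg {d : ℕ} (μ : Measure (Fin d → ℝ)) (i : DIdx d) (f : (Fin d → ℝ) → ℝ≥0∞) : ℝ≥0∞ :=
  (∫⁻ x in dcube i, f x ∂μ) / μ (dcube i)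

/-- Lebesgue average of a nonnegative function over a dyadic cube. -/
def lavg {d : ℕ} (i : DIdx d) (f : (Fin d → ℝ) → ℝ≥0∞) : ℝ≥0∞ :=
  cavg volume i f

/-- The `L^p` norm (real exponent `p`) of a nonnegative function with respect to `μ`. -/
def lpn {d : ℕ} (p : ℝ) (μ : Measure (Fin d → ℝ)) (f : (Fin d → ℝ) → ℝ≥0∞) : ℝ≥0∞ :=
  (∫⁻ x, f x ^ p ∂μ) ^ (1 / p)

/-- The positive dyadic operator `T_τ f = ∑_Q τ_Q (E_Q f) 1_Q`. -/
def Tdy {d : ℕ} (τ : DIdx d → ℝ≥0∞) (f : (Fin d → ℝ) → ℝ≥0∞) (x : Fin d → ℝ) : ℝ≥0∞ :=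
  ∑' i : DIdx d, (dcube i).indicator (fun _ => τ i * lavg i f) x

/-- The local part `T^in_{τ,R} f = ∑_{Q ⊆ R} τ_Q (E_Q f) 1_Q`. -/
def TdyIn {d : ℕ} (τ : DIdx d → ℝ≥0∞) (R : DIdx d) (f : (Fin d → ℝ) → ℝ≥0∞)
    (x : Fin d → ℝ) : ℝ≥0∞ :=
  ∑' i : {i : DIdx d // dcube i ⊆ dcube R},
    (dcube i.1).indicator (fun _ => τ i.1 * lavg i.1 f) x

/-- The global part `T^out_{τ,R} f = ∑_{Q ⊇ R} τ_Q (E_Q f) 1_Q`. -/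
def TdyOut {d : ℕ} (τ : DIdx d → ℝ≥0∞) (R : DIdx d) (f : (Fin d → ℝ) → ℝ≥0∞)
    (x : Fin d → ℝ) : ℝ≥0∞ :=
  ∑' i : {i : DIdx d // dcube R ⊆ dcube i},
    (dcube i.1).indicator (fun _ => τ i.1 * lavg i.1 f) x

/-- The local testing constant `⟦σ,ω⟧^Loc_{τ,p,q}
= sup_{R : ω(R)>0} ω(R)^{-1/q'} ‖T^in_{τ,R}(1_R ω)‖_{L^{p'}(σ)}`. -/
def locTest {d : ℕ} (p q : ℝ) (τ : DIdx d → ℝ≥0∞) (σ ω : (Fin d → ℝ) → ℝ≥0∞) : ℝ≥0∞ :=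
  ⨆ (R : DIdx d) (_ : wMeasure ω (dcube R) ≠ 0),
    wMeasure ω (dcube R) ^ (-(1 / (q / (q - 1)))) *
      lpn (p / (p - 1)) (wMeasure σ) (TdyIn τ R ((dcube R).indicator ω))

/-- The global testing constant `⟦σ,ω⟧^Glo_{τ,p,q}
= sup_{R : ω(R)>0} ω(R)^{-1/q'} ‖T^out_{τ,R}(1_R ω)‖_{L^{p'}(σ)}`. -/
def gloTest {d : ℕ} (p q : ℝ) (τ : DIdx d → ℝ≥0∞) (σ ω : (Fin d → ℝ) → ℝ≥0∞) : ℝ≥0∞ :=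
  ⨆ (R : DIdx d) (_ : wMeasure ω (dcube R) ≠ 0),
    wMeasure ω (dcube R) ^ (-(1 / (q / (q - 1)))) *
      lpn (p / (p - 1)) (wMeasure σ) (TdyOut τ R ((dcube R).indicator ω))

/-- The least weak-type `L^p(σ) → L^{q,∞}(ω)` constant of `f ↦ T_τ(fσ)`. -/
def weakConst {d : ℕ} (p q : ℝ) (τ : DIdx d → ℝ≥0∞) (σ ω : (Fin d → ℝ) → ℝ≥0∞) : ℝ≥0∞ :=
  sInf {N : ℝ≥0∞ | ∀ f : (Fin d → ℝ) → ℝ≥0∞, Measurable f → lpn p (wMeasure σ) f ≠ ⊤ →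
    ∀ lam : ℝ≥0∞, 0 < lam →
      wMeasure ω {x | lam < Tdy τ (fun y => f y * σ y) x} ≤
        (N * lpn p (wMeasure σ) f / lam) ^ q}


lemma measurableSet_dcube {d : ℕ} (i : DIdx d) : MeasurableSet (dcube i) := by
  have : dcube i = Set.pi Set.univ fun j =>
      Set.Ico ((2 : ℝ) ^ i.1 * (i.2 j : ℝ)) ((2 : ℝ) ^ i.1 * ((i.2 j : ℝ) + 1)) := by
    ext x; simp [dcube]
  rw [this]
  exact MeasurableSet.univ_pi fun j => measurableSet_Ico

/-- A measure that is finite on all dyadic cubes is σ-finite. -/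
lemma sigmaFinite_of_dcube_ne_top {d : ℕ} (μ : Measure (Fin d → ℝ))
    (h : ∀ i : DIdx d, μ (dcube i) ≠ ⊤) : SigmaFinite μ := by
  refine Measure.sigmaFinite_of_countable (S := Set.range (dcube (d := d)))
    (Set.countable_range _) ?_ ?_
  · rintro _ ⟨i, rfl⟩
    exact (h i).lt_top
  · refine Set.eq_univ_of_forall fun x => ⟨_, ⟨(0, fun j => ⌊x j⌋), rfl⟩, fun j => ?_⟩
    simp [Int.floor_le, Int.lt_floor_add_one]

/-- Converse of Hölder's inequality: a bound for the pairings of `G` with `L^p` functions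
bounds the norm of `G` in the dual space. -/
lemma lpn_le_of_forall_lintegral_mul_le {d : ℕ} {p : ℝ} (hp : 1 < p)
    (μ : Measure (Fin d → ℝ)) [SigmaFinite μ] {G : (Fin d → ℝ) → ℝ≥0∞} (hG : Measurable G)
    {A : ℝ≥0∞}
    (h : ∀ f : (Fin d → ℝ) → ℝ≥0∞, Measurable f → lpn p μ f ≠ ⊤ →
      ∫⁻ x, G x * f x ∂μ ≤ A * lpn p μ f) :
    lpn (p / (p - 1)) μ G ≤ A := by
  set r := p / (p - 1) with hr
  have hp0 : 0 < p := by linarith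
  have hp1 : 0 < p - 1 := by linarith
  have hr0 : 0 < r := by positivity
  have hr1 : r - 1 = 1 / (p - 1) := by rw [hr]; field_simp; ring
  have hr1p : (r - 1) * p = r := by rw [hr1, hr]; ring
  have hconj : 1 / r = 1 - 1 / p := by rw [hr]; field_simp
  have hr10 : 0 < r - 1 := by rw [hr1]; positivity
  set g : ℕ → (Fin d → ℝ) → ℝ≥0∞ := fun n =>
    (spanningSets μ n).indicator (fun x => min (G x) n) with hg
  have hgm : ∀ n, Measurable (g n) := fun n =>
    (hG.min measurable_const).indicator (measurableSet_spanningSets μ n)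
  have hgG : ∀ n x, g n x ≤ G x := fun n x =>
    (Set.indicator_le_self _ _ x).trans (min_le_left _ _)
  have hmono : Monotone g := by
    intro m n hmn x
    refine (Set.indicator_le_indicator_of_subset (monotone_spanningSets μ hmn)
      (fun _ => zero_le) x).trans (Set.indicator_le_indicator ?_)
    exact min_le_min le_rfl (by exact_mod_cast hmn)
  have hfin : ∀ n, ∫⁻ x, g n x ^ r ∂μ ≠ ⊤ := by
    intro n
    have : ∀ x, g n x ^ r ≤ (spanningSets μ n).indicator (fun _ => (n : ℝ≥0∞) ^ r) x := by
      intro x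
      by_cases hx : x ∈ spanningSets μ n
      · simp only [hg, Set.indicator_of_mem hx]
        exact ENNReal.rpow_le_rpow (min_le_right _ _) hr0.le
      · simp [hg, hx, hr0]
    refine ((lintegral_mono this).trans_lt ?_).ne
    rw [lintegral_indicator_const (measurableSet_spanningSets μ n)]
    exact ENNReal.mul_lt_top (ENNReal.rpow_lt_top_of_nonneg hr0.le (by simp))
      (measure_spanningSets_lt_top μ n)
  have hbound : ∀ n, ∫⁻ x, g n x ^ r ∂μ ≤ A ^ r := by
    intro n
    set I := ∫⁻ x, g n x ^ r ∂μ with hI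
    rcases eq_or_ne I 0 with h0 | h0
    · simp [h0]
    have hnorm : lpn p μ (fun x => g n x ^ (r - 1)) = I ^ (1 / p) := by
      simp only [lpn, ← ENNReal.rpow_mul, hr1p, hI]
    have hIle : I ≤ A * I ^ (1 / p) := by
      rw [← hnorm]
      refine le_trans (lintegral_mono fun x => ?_) (h _ ((hgm n).pow_const _) ?_)
      · calc g n x ^ r = g n x * g n x ^ (r - 1) := by
              conv_rhs => enter [1]; rw [← ENNReal.rpow_one (g n x)]
              rw [← ENNReal.rpow_add_of_nonneg _ _ zero_le_one hr10.le]
              congr 1; ring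
          _ ≤ G x * g n x ^ (r - 1) := by gcongr; exact hgG n x
      · rw [hnorm]
        exact ENNReal.rpow_ne_top_of_nonneg (by positivity) (hfin n)
    have hI1 : I ^ (1 / r) ≤ A := by
      rw [hconj, ENNReal.rpow_sub _ _ h0 (hfin n), ENNReal.rpow_one]
      exact ENNReal.div_le_of_le_mul hIle
    calc I = (I ^ (1 / r)) ^ r := by
            rw [← ENNReal.rpow_mul, one_div, inv_mul_cancel₀ hr0.ne', ENNReal.rpow_one]
      _ ≤ A ^ r := ENNReal.rpow_le_rpow hI1 hr0.le
  have hsup : ∀ x, G x ^ r ≤ ⨆ n, g n x ^ r := by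
    intro x
    obtain ⟨m, hm⟩ : ∃ m, x ∈ spanningSets μ m := by
      have : x ∈ ⋃ m, spanningSets μ m := iUnion_spanningSets μ ▸ Set.mem_univ x
      exact Set.mem_iUnion.1 this
    have hlim : Filter.Tendsto (fun n : ℕ => min (G x) (n : ℝ≥0∞)) Filter.atTop
        (nhds (min (G x) ⊤)) :=
      tendsto_const_nhds.min ENNReal.tendsto_nat_nhds_top
    rw [min_top_right] at hlim
    refine le_of_tendsto ((ENNReal.continuous_rpow_const (y := r)).tendsto _ |>.comp hlim) ?_
    filter_upwards [Filter.eventually_ge_atTop m] with n hn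
    refine le_iSup_of_le n (le_of_eq ?_)
    simp only [hg, Function.comp, Set.indicator_of_mem (monotone_spanningSets μ hn hm)]
  have hint : ∫⁻ x, G x ^ r ∂μ ≤ A ^ r := by
    refine (lintegral_mono hsup).trans ?_
    rw [lintegral_iSup (fun n => (hgm n).pow_const r)
      (fun m n hmn x => ENNReal.rpow_le_rpow (hmono hmn x) hr0.le)]
    exact iSup_le hbound
  calc lpn r μ G ≤ (A ^ r) ^ (1 / r) := ENNReal.rpow_le_rpow hint (by positivity)
    _ = A := by rw [← ENNReal.rpow_mul, mul_one_div_cancel hr0.ne', ENNReal.rpow_one]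

lemma measurable_TdyOut {d : ℕ} (τ : DIdx d → ℝ≥0∞) (R : DIdx d) (f : (Fin d → ℝ) → ℝ≥0∞) :
    Measurable (TdyOut τ R f) :=
  Measurable.tsum fun i => measurable_const.indicator (measurableSet_dcube i.1)

/-- On `R`, the function `T_τ(fσ)` dominates the pairing of `f` with `T^out_{τ,R}(1_R ω)`,
normalized by `ω(R)`. -/
lemma lintegral_TdyOut_mul_le {d : ℕ} (τ : DIdx d → ℝ≥0∞) {σ ω f : (Fin d → ℝ) → ℝ≥0∞}
    (hσ : Measurable σ) (hf : Measurable f) (R : DIdx d) {x : Fin d → ℝ} (hx : x ∈ dcube R) :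
    ∫⁻ y, TdyOut τ R ((dcube R).indicator ω) y * f y ∂(wMeasure σ) ≤
      wMeasure ω (dcube R) * Tdy τ (fun y => f y * σ y) x := by
  have hlavg : ∀ i : {i : DIdx d // dcube R ⊆ dcube i},
      lavg i.1 ((dcube R).indicator ω) = wMeasure ω (dcube R) / volume (dcube i.1) := by
    intro i
    rw [lavg, cavg, lintegral_indicator (measurableSet_dcube R),
      Measure.restrict_restrict (measurableSet_dcube R), Set.inter_eq_left.2 i.2,
      wMeasure, withDensity_apply _ (measurableSet_dcube R)]
  have hterm : ∀ i : {i : DIdx d // dcube R ⊆ dcube i},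
      ∫⁻ y, (dcube i.1).indicator (fun _ => τ i.1 * lavg i.1 ((dcube R).indicator ω)) y * f y
        ∂(wMeasure σ) =
      wMeasure ω (dcube R) * (dcube i.1).indicator
        (fun _ => τ i.1 * lavg i.1 (fun y => f y * σ y)) x := by
    intro i
    have hmul : ∀ y, (dcube i.1).indicator
        (fun _ => τ i.1 * lavg i.1 ((dcube R).indicator ω)) y * f y =
        τ i.1 * lavg i.1 ((dcube R).indicator ω) * (dcube i.1).indicator f y := by
      intro y
      by_cases hy : y ∈ dcube i.1 <;> simp [hy]
    have hpair : ∫⁻ y in dcube i.1, f y ∂(wMeasure σ) = ∫⁻ y in dcube i.1, f y * σ y := by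
      rw [wMeasure, setLIntegral_withDensity_eq_setLIntegral_mul _ hσ hf
        (measurableSet_dcube i.1)]
      simp only [Pi.mul_apply, mul_comm]
    simp_rw [hmul]
    rw [lintegral_const_mul _ (hf.indicator (measurableSet_dcube i.1)),
      lintegral_indicator (measurableSet_dcube i.1), Set.indicator_of_mem (i.2 hx), hlavg i,
      hpair, lavg, cavg]
    simp only [div_eq_mul_inv]
    ring
  let F : DIdx d → ℝ≥0∞ := fun i =>
    (dcube i).indicator (fun _ => τ i * lavg i (fun y => f y * σ y)) x
  have hsum : ∫⁻ y, TdyOut τ R ((dcube R).indicator ω) y * f y ∂(wMeasure σ) =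
      wMeasure ω (dcube R) * ∑' i : {i : DIdx d // dcube R ⊆ dcube i}, F i.1 := by
    simp only [TdyOut, ← ENNReal.tsum_mul_right, ← ENNReal.tsum_mul_left]
    have hmeas : ∀ i : {i : DIdx d // dcube R ⊆ dcube i}, AEMeasurable (fun y =>
        (dcube i.1).indicator (fun _ => τ i.1 * lavg i.1 ((dcube R).indicator ω)) y * f y)
        (wMeasure σ) := by
      intro i
      have hind : Measurable ((dcube i.1).indicator
          (fun _ : Fin d → ℝ => τ i.1 * lavg i.1 ((dcube R).indicator ω))) :=
        measurable_const.indicator (measurableSet_dcube i.1)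
      exact (hind.mul hf).aemeasurable
    rw [lintegral_tsum hmeas]
    exact tsum_congr hterm
  rw [hsum]
  gcongr
  exact ENNReal.tsum_comp_le_tsum_of_injective Subtype.val_injective F

/-- **Necessity of the global testing condition.** -/
theorem stmt9 (d : ℕ) (p q : ℝ) (hp : 1 < p) (hpq : p ≤ q) :
    ∃ C : ℝ≥0∞, 0 < C ∧ C < ⊤ ∧
      ∀ (τ : DIdx d → ℝ≥0∞) (σ ω : (Fin d → ℝ) → ℝ≥0∞),
        Measurable σ → Measurable ω →
        (∀ i : DIdx d, wMeasure σ (dcube i) ≠ ⊤) →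
        (∀ i : DIdx d, wMeasure ω (dcube i) ≠ ⊤) →
        ∀ N : ℝ≥0∞, N ≠ ⊤ →
          (∀ f : (Fin d → ℝ) → ℝ≥0∞, Measurable f → lpn p (wMeasure σ) f ≠ ⊤ →
            ∀ lam : ℝ≥0∞, 0 < lam →
              wMeasure ω {x | lam < Tdy τ (fun y => f y * σ y) x} ≤
                (N * lpn p (wMeasure σ) f / lam) ^ q) →
          ∀ R : DIdx d, wMeasure ω (dcube R) ≠ 0 →
            lpn (p / (p - 1)) (wMeasure σ) (TdyOut τ R ((dcube R).indicator ω)) ≤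
              C * N * wMeasure ω (dcube R) ^ (1 / (q / (q - 1))) := by
  refine ⟨1, one_pos, one_lt_top, ?_⟩
  intro τ σ ω hσ _ hσf hωf N hN hweak R hR
  have hq : 1 < q := hp.trans_le hpq
  have hq0 : 0 < q := by linarith
  have hRt := hωf R
  have := sigmaFinite_of_dcube_ne_top (wMeasure σ) hσf
  refine lpn_le_of_forall_lintegral_mul_le hp _ (measurable_TdyOut τ R _) fun f hf hfn => ?_
  set W := wMeasure ω (dcube R) with hW
  set M := ∫⁻ y, TdyOut τ R ((dcube R).indicator ω) y * f y ∂(wMeasure σ) with hM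
  have hWq : W ^ (1 / (q / (q - 1))) = W / W ^ (1 / q) := by
    have : 1 / (q / (q - 1)) = 1 - 1 / q := by field_simp
    rw [this, ENNReal.rpow_sub _ _ hR hRt, ENNReal.rpow_one]
  have hW0 : W ^ (1 / q) ≠ 0 := (ENNReal.rpow_pos (pos_iff_ne_zero.2 hR) hRt).ne'
  have hWt : W ^ (1 / q) ≠ ⊤ := ENNReal.rpow_ne_top_of_nonneg (by positivity) hRt
  have hlevel : M / W ≤ N * lpn p (wMeasure σ) f / W ^ (1 / q) := by
    refine le_of_forall_lt fun lam hlam => ?_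
    obtain ⟨l, hl, hlM⟩ := exists_between hlam
    refine hl.trans_le ?_
    have hl0 : 0 < l := zero_le.trans_lt hl
    have hsub : dcube R ⊆ {x | l < Tdy τ (fun y => f y * σ y) x} := fun x hx =>
      hlM.trans_le (ENNReal.div_le_of_le_mul'
        (lintegral_TdyOut_mul_le τ hσ hf R hx))
    have hle : W ^ (1 / q) ≤ N * lpn p (wMeasure σ) f / l := by
      have := ENNReal.rpow_le_rpow ((measure_mono hsub).trans (hweak f hf hfn l hl0))
        (z := 1 / q) (by positivity)
      rwa [← ENNReal.rpow_mul, mul_one_div_cancel hq0.ne', ENNReal.rpow_one] at this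
    rw [ENNReal.le_div_iff_mul_le (.inl hW0) (.inl hWt), mul_comm]
    exact ENNReal.mul_le_of_le_div hle
  calc M = M / W * W := (ENNReal.div_mul_cancel hR hRt).symm
    _ ≤ N * lpn p (wMeasure σ) f / W ^ (1 / q) * W := by gcongr
    _ = 1 * N * W ^ (1 / (q / (q - 1))) * lpn p (wMeasure σ) f := by
        rw [hWq]; simp only [div_eq_mul_inv]; ring
end
end

section
/- (Whitney decomposition of a nested family of open sets.) Let ρ ≥ 1 be an integer and let (Ω_k)_{k∈ℤ} be open subsets of ℝ^d with Ω_{k+1} ⊆ Ω_k for all k, such that for every k and every x ∈ Ω_k some dyadic ancestor of x is not contained in Ω_k. Then there exist collections 𝒬_k of pairwise disjoint dyadic cubes satisfying: (i) Ω_k = ⋃_{Q∈𝒬_k} Q; (ii) for every Q ∈ 𝒬_k, Q^{(ρ)} ⊆ Ω_k and Q^{(ρ+1)} ∩ Ω_k^c ≠ ∅; (iii) ∑_{Q∈𝒬_k} 1_{Q^{(ρ)}} ≤ C(ρ,d) 1_{Ω_k} pointwise; (iv) for every Q ∈ 𝒬_k, the number of Q' ∈ 𝒬_k with Q' ∩ Q^{(ρ)}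 ≠ ∅ is at most C(ρ,d); (v) if Q ∈ 𝒬_k, Q' ∈ 𝒬_l and Q ⊊ Q', then k > l. -/
open MeasureTheory ENNReal

noncomputable section

/-- The index of the dyadic cube of scale `s` containing `x`. -/
def cubeAt {d : ℕ} (x : Fin d → ℝ) (s : ℤ) : DIdx d :=
  (s, fun j => ⌊x j / (2 : ℝ) ^ s⌋)

theorem mem_dcube_iff {d : ℕ} {x : Fin d → ℝ} {i : DIdx d} :
    x ∈ dcube i ↔ cubeAt x i.1 = i := by
  obtain ⟨s, m⟩ := i
  have hs : (0 : ℝ) < 2 ^ s := by positivity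
  simp only [dcube, cubeAt, Set.mem_ofPred_eq, Set.mem_Ico, Prod.mk.injEq, true_and, funext_iff,
    Int.floor_eq_iff, le_div_iff₀ hs, div_lt_iff₀ hs, mul_comm]

theorem mem_dcube_cubeAt {d : ℕ} {x y : Fin d → ℝ} {s : ℤ} :
    y ∈ dcube (cubeAt x s) ↔ cubeAt y s = cubeAt x s :=
  mem_dcube_iff

theorem dcube_nonempty {d : ℕ} (i : DIdx d) : (dcube i).Nonempty := by
  refine ⟨fun j => (2 : ℝ) ^ i.1 * (i.2 j : ℝ), fun j => ⟨le_rfl, ?_⟩⟩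
  have hs : (0 : ℝ) < 2 ^ i.1 := by positivity
  exact mul_lt_mul_of_pos_left (lt_add_one _) hs

theorem dparent_cubeAt {d : ℕ} (x : Fin d → ℝ) (s : ℤ) :
    dparent (cubeAt x s) = cubeAt x (s + 1) := by
  refine Prod.ext rfl (funext fun j => ?_)
  change Int.fdiv ⌊x j / (2 : ℝ) ^ s⌋ 2 = ⌊x j / (2 : ℝ) ^ (s + 1)⌋
  rw [Int.fdiv_eq_ediv_of_nonneg _ (by norm_num), zpow_add_one₀ two_ne_zero, ← div_div]
  exact (Int.floor_div_natCast (x j / (2 : ℝ) ^ s) 2).symm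

theorem iterate_dparent_cubeAt {d : ℕ} (x : Fin d → ℝ) (s : ℤ) (n : ℕ) :
    dparent^[n] (cubeAt x s) = cubeAt x (s + n) := by
  induction n with
  | zero => simp
  | succ n ih =>
    rw [Function.iterate_succ_apply', ih, dparent_cubeAt]
    push_cast
    rw [add_assoc]

theorem dcube_cubeAt_mono {d : ℕ} (x : Fin d → ℝ) : Monotone fun s => dcube (cubeAt x s) := by
  refine monotone_int_of_le_succ fun s y hy => ?_
  rw [mem_dcube_cubeAt] at hy ⊢
  rw [← dparent_cubeAt, ← dparent_cubeAt, hy]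

theorem dcube_subset_iterate_dparent {d : ℕ} (i : DIdx d) (n : ℕ) :
    dcube i ⊆ dcube (dparent^[n] i) := by
  obtain ⟨x, hx⟩ := dcube_nonempty i
  rw [← mem_dcube_iff.1 hx, iterate_dparent_cubeAt]
  exact dcube_cubeAt_mono x (by lia)

theorem iterate_dparent_eq {d : ℕ} (i : DIdx d) (n : ℕ) :
    dparent^[n] i = (i.1 + n, fun j => i.2 j / 2 ^ n) := by
  induction n with
  | zero => simp
  | succ n ih =>
    rw [Function.iterate_succ_apply', ih]
    refine Prod.ext (by simp [dparent, add_assoc]) (funext fun j => ?_)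
    change Int.fdiv (i.2 j / 2 ^ n) 2 = i.2 j / 2 ^ (n + 1)
    rw [Int.fdiv_eq_ediv_of_nonneg _ (by norm_num), pow_succ,
      Int.ediv_ediv_of_nonneg (by positivity)]

/-- A dyadic cube has at most `2^{nd}` descendants of generation `n`. -/
theorem encard_iterate_dparent_fiber_le {d : ℕ} (n : ℕ) (R : DIdx d) :
    {i : DIdx d | dparent^[n] i = R}.encard ≤ (((2 ^ n) ^ d : ℕ) : ℕ∞) := by
  have hpos : (0 : ℤ) < 2 ^ n := by positivity
  let T : Finset (Fin d → ℤ) := Fintype.piFinset fun _ => Finset.Ico (0 : ℤ) (2 ^ n)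
  have hT : (T : Set (Fin d → ℤ)).encard = (((2 ^ n) ^ d : ℕ) : ℕ∞) := by
    rw [Set.encard_coe_eq_coe_finsetCard]
    simp [T, Fintype.card_piFinset, Int.toNat_pow_of_nonneg]
  rw [← hT]
  refine Set.encard_le_encard_of_injOn (f := fun i j => i.2 j % 2 ^ n) ?_ ?_
  · intro i _
    simp only [T, Finset.mem_coe, Fintype.mem_piFinset, Finset.mem_Ico]
    exact fun j => ⟨Int.emod_nonneg _ hpos.ne', Int.emod_lt_of_pos _ hpos⟩
  · intro i hi i' hi' h
    have hq : dparent^[n] i = dparent^[n] i' := Eq.trans hi (Eq.symm hi')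
    rw [iterate_dparent_eq, iterate_dparent_eq, Prod.mk.injEq] at hq
    refine Prod.ext (add_right_cancel hq.1) (funext fun j => ?_)
    rw [← Int.mul_ediv_add_emod (i.2 j) (2 ^ n), ← Int.mul_ediv_add_emod (i'.2 j) (2 ^ n),
      congrFun hq.2 j]
    exact congrArg _ (congrFun h j)

theorem exists_dcube_cubeAt_subset {d : ℕ} {U : Set (Fin d → ℝ)} (hU : IsOpen U)
    {x : Fin d → ℝ} (hx : x ∈ U) : ∃ s, dcube (cubeAt x s) ⊆ U := by
  obtain ⟨ε, hε, hball⟩ := Metric.isOpen_iff.1 hU x hx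
  obtain ⟨n, hn⟩ := exists_pow_lt_of_lt_one hε (by norm_num : (2 : ℝ)⁻¹ < 1)
  refine ⟨-n, fun y hy => hball ?_⟩
  have hxx : x ∈ dcube (cubeAt x (-n)) := mem_dcube_cubeAt.2 rfl
  have hlen : (2 : ℝ) ^ (-n : ℤ) < ε := by simpa using hn
  rw [Metric.mem_ball, dist_pi_lt_iff hε]
  intro j
  obtain ⟨h1, h2⟩ := hy j
  obtain ⟨h3, h4⟩ := hxx j
  simp only [cubeAt, mul_add, mul_one] at h1 h2 h3 h4
  rw [Real.dist_eq, abs_lt]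
  constructor <;> linarith

/-- The dyadic cubes whose `ρ`-th ancestor, but not the next one, lies in `U`. -/
def whitneyCubes {d : ℕ} (ρ : ℕ) (U : Set (Fin d → ℝ)) : Set (DIdx d) :=
  {i | dcube (dparent^[ρ] i) ⊆ U ∧ ¬dcube (dparent^[ρ + 1] i) ⊆ U}

theorem cubeAt_mem_whitneyCubes {d ρ : ℕ} {U : Set (Fin d → ℝ)} {x : Fin d → ℝ} {s : ℤ} :
    cubeAt x s ∈ whitneyCubes ρ U ↔
      dcube (cubeAt x (s + ρ)) ⊆ U ∧ ¬dcube (cubeAt x (s + ρ + 1)) ⊆ U := by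
  simp [whitneyCubes, iterate_dparent_cubeAt, -Function.iterate_succ, add_assoc]

/-- Two Whitney cubes with intersecting `ρ`-th ancestors have the same `ρ`-th ancestor. -/
theorem iterate_dparent_eq_of_mem_whitneyCubes {d ρ : ℕ} {U : Set (Fin d → ℝ)} {i j : DIdx d}
    (hi : i ∈ whitneyCubes ρ U) (hj : j ∈ whitneyCubes ρ U) {x : Fin d → ℝ}
    (hxi : x ∈ dcube (dparent^[ρ] i)) (hxj : x ∈ dcube (dparent^[ρ] j)) :
    dparent^[ρ] i = dparent^[ρ] j := by
  simp only [whitneyCubes, Set.mem_ofPred_eq, Function.iterate_succ_apply'] at hi hj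
  rw [← mem_dcube_iff.1 hxi, dparent_cubeAt] at hi
  rw [← mem_dcube_iff.1 hxj, dparent_cubeAt] at hj
  rw [← mem_dcube_iff.1 hxi, ← mem_dcube_iff.1 hxj]
  congr 1
  refine le_antisymm (not_lt.1 fun h => hj.2 ?_) (not_lt.1 fun h => hi.2 ?_)
  · exact (dcube_cubeAt_mono x h).trans hi.1
  · exact (dcube_cubeAt_mono x h).trans hj.1

theorem pairwise_disjoint_whitneyCubes {d : ℕ} (ρ : ℕ) (U : Set (Fin d → ℝ)) :
    (whitneyCubes ρ U).Pairwise fun i j => Disjoint (dcube i) (dcube j) := by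
  intro i hi j hj hij
  refine Set.disjoint_left.2 fun x hxi hxj => hij ?_
  have h := iterate_dparent_eq_of_mem_whitneyCubes hi hj
    (dcube_subset_iterate_dparent i ρ hxi) (dcube_subset_iterate_dparent j ρ hxj)
  rw [iterate_dparent_eq, iterate_dparent_eq, Prod.mk.injEq] at h
  rw [← mem_dcube_iff.1 hxi, ← mem_dcube_iff.1 hxj, add_right_cancel h.1]

theorem eq_iUnion_whitneyCubes {d : ℕ} (ρ : ℕ) {U : Set (Fin d → ℝ)} (hU : IsOpen U)
    (hex : ∀ x ∈ U, ∃ i : DIdx d, x ∈ dcube i ∧ ¬dcube i ⊆ U) :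
    U = ⋃ i ∈ whitneyCubes ρ U, dcube i := by
  refine Set.Subset.antisymm (fun x hx => ?_)
    (Set.iUnion₂_subset fun i hi => (dcube_subset_iterate_dparent i ρ).trans hi.1)
  obtain ⟨i, hxi, hi⟩ := hex x hx
  rw [← mem_dcube_iff.1 hxi] at hi
  obtain ⟨s, hs, hmax⟩ := Int.exists_greatest_of_bdd (P := fun s => dcube (cubeAt x s) ⊆ U)
    ⟨i.1, fun s hs => not_lt.1 fun h => hi ((dcube_cubeAt_mono x h.le).trans hs)⟩
    (exists_dcube_cubeAt_subset hU hx)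
  refine Set.mem_iUnion₂.2 ⟨cubeAt x (s - ρ), ?_, mem_dcube_cubeAt.2 rfl⟩
  rw [cubeAt_mem_whitneyCubes, sub_add_cancel]
  exact ⟨hs, fun h => (lt_add_one s).not_ge (hmax _ h)⟩

theorem encard_whitneyCubes_mem_le {d : ℕ} (ρ : ℕ) (U : Set (Fin d → ℝ)) (x : Fin d → ℝ) :
    {i ∈ whitneyCubes ρ U | x ∈ dcube (dparent^[ρ] i)}.encard ≤ (((2 ^ ρ) ^ d : ℕ) : ℕ∞) := by
  rcases Set.eq_empty_or_nonempty {i ∈ whitneyCubes ρ U | x ∈ dcube (dparent^[ρ] i)} with h | h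
  · simp [h]
  · obtain ⟨i, hi, hxi⟩ := h
    refine (Set.encard_le_encard ?_).trans (encard_iterate_dparent_fiber_le ρ (dparent^[ρ] i))
    exact fun j hj => iterate_dparent_eq_of_mem_whitneyCubes hj.1 hi hj.2 hxi

theorem encard_whitneyCubes_inter_le {d ρ : ℕ} {U : Set (Fin d → ℝ)} {i : DIdx d}
    (hi : i ∈ whitneyCubes ρ U) :
    {j ∈ whitneyCubes ρ U | (dcube j ∩ dcube (dparent^[ρ] i)).Nonempty}.encard ≤
      (((2 ^ ρ) ^ d : ℕ) : ℕ∞) := by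
  refine (Set.encard_le_encard ?_).trans (encard_iterate_dparent_fiber_le ρ (dparent^[ρ] i))
  rintro j ⟨hj, x, hxj, hxi⟩
  exact iterate_dparent_eq_of_mem_whitneyCubes hj hi (dcube_subset_iterate_dparent j ρ hxj) hxi

theorem tsum_indicator_whitneyCubes_le {d : ℕ} (ρ : ℕ) (U : Set (Fin d → ℝ)) (x : Fin d → ℝ) :
    (∑' i : whitneyCubes ρ U, (dcube (dparent^[ρ] i.1)).indicator (fun _ => (1 : ℝ≥0∞)) x) ≤
      (((2 ^ ρ) ^ d : ℕ) : ℝ≥0∞) * U.indicator (fun _ => (1 : ℝ≥0∞)) x := by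
  classical
  by_cases hx : x ∈ U
  · have key : (∑' i : whitneyCubes ρ U,
        (dcube (dparent^[ρ] i.1)).indicator (fun _ => (1 : ℝ≥0∞)) x) =
        ({i ∈ whitneyCubes ρ U | x ∈ dcube (dparent^[ρ] i)}.encard : ℝ≥0∞) := by
      rw [← ENNReal.tsum_set_one, tsum_subtype (whitneyCubes ρ U)
        (fun i => (dcube (dparent^[ρ] i)).indicator (fun _ => (1 : ℝ≥0∞)) x),
        tsum_subtype _ (fun _ => (1 : ℝ≥0∞))]
      refine tsum_congr fun i => ?_
      simp only [Set.indicator_apply, Set.mem_ofPred_eq, ite_and]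
    rw [key, Set.indicator_of_mem hx, mul_one]
    exact_mod_cast ENat.toENNReal_le.2 (encard_whitneyCubes_mem_le ρ U x)
  · refine (ENNReal.tsum_eq_zero.2 fun i => ?_).trans_le zero_le
    exact Set.indicator_of_notMem (fun h => hx (i.2.1 h)) _

theorem not_subset_of_dcube_ssubset {d ρ : ℕ} {U V : Set (Fin d → ℝ)} {i j : DIdx d}
    (hi : i ∈ whitneyCubes ρ U) (hj : j ∈ whitneyCubes ρ V) (hij : dcube i ⊂ dcube j) :
    ¬V ⊆ U := by
  intro hVU
  obtain ⟨x, hx⟩ := dcube_nonempty i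
  have hxi := mem_dcube_iff.1 hx
  have hxj := mem_dcube_iff.1 (hij.1 hx)
  rw [← hxi, ← hxj] at hij
  rw [← hxi, cubeAt_mem_whitneyCubes] at hi
  rw [← hxj, cubeAt_mem_whitneyCubes] at hj
  have hlt : i.1 < j.1 := not_le.1 fun h => hij.2 (dcube_cubeAt_mono x h)
  exact hi.2 ((dcube_cubeAt_mono x (by lia)).trans (hj.1.trans hVU))

/-- **Whitney decomposition of a nested family of open sets.** -/
theorem stmt13 (d ρ : ℕ) (hρ : 1 ≤ ρ) :
    ∃ C : ℕ, 0 < C ∧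
      ∀ Ω : ℤ → Set (Fin d → ℝ),
        (∀ k, IsOpen (Ω k)) →
        (∀ k, Ω (k + 1) ⊆ Ω k) →
        (∀ k, ∀ x ∈ Ω k, ∃ i : DIdx d, x ∈ dcube i ∧ ¬dcube i ⊆ Ω k) →
        ∃ 𝒬 : ℤ → Set (DIdx d),
          (∀ k, (𝒬 k).Pairwise fun i j => Disjoint (dcube i) (dcube j)) ∧
          (∀ k, Ω k = ⋃ i ∈ 𝒬 k, dcube i) ∧
          (∀ k, ∀ i ∈ 𝒬 k,
            dcube (dparent^[ρ] i) ⊆ Ω k ∧ (dcube (dparent^[ρ + 1] i) ∩ (Ω k)ᶜ).Nonempty) ∧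
          (∀ k x, (∑' i : 𝒬 k, (dcube (dparent^[ρ] i.1)).indicator (fun _ => (1 : ℝ≥0∞)) x) ≤
            (C : ℝ≥0∞) * (Ω k).indicator (fun _ => (1 : ℝ≥0∞)) x) ∧
          (∀ k, ∀ i ∈ 𝒬 k,
            {j ∈ 𝒬 k | (dcube j ∩ dcube (dparent^[ρ] i)).Nonempty}.encard ≤ (C : ℕ∞)) ∧
          (∀ k l i j, i ∈ 𝒬 k → j ∈ 𝒬 l → dcube i ⊂ dcube j → l < k) := by
  refine ⟨(2 ^ ρ) ^ d, by positivity, fun Ω hopen hnest hex => ?_⟩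
  refine ⟨fun k => whitneyCubes ρ (Ω k), fun k => pairwise_disjoint_whitneyCubes ρ (Ω k),
    fun k => eq_iUnion_whitneyCubes ρ (hopen k) (hex k),
    fun k i hi => ⟨hi.1, Set.inter_compl_nonempty_iff.2 hi.2⟩,
    fun k x => tsum_indicator_whitneyCubes_le ρ (Ω k) x,
    fun k i hi => encard_whitneyCubes_inter_le hi, fun k l i j hi hj hij => ?_⟩
  exact not_le.1 fun h => not_subset_of_dcube_ssubset hi hj hij (antitone_int_of_succ_le hnest h)
end
end

section
/- (Existence of principal cubes.) Let σ be a weight on ℝ^d, let f ≥ 0 be integrable with respect to σ dx, and let 𝒮 be a finite collection of dyadic cubes, each with σ(Q) > 0. Then there exists a subcollection 𝒢 ⊆ 𝒮 such that: (i) for every Q ∈ 𝒮 there is G ∈ 𝒢 with Q ⊆ G and E_Q^σ f ≤ 2 E_G^σ f; (ii) whenever G, G' ∈ 𝒢 with G ⊊ G', one has 2 E_{G'}^σ f < E_G^σ f. -/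
open MeasureTheory ENNReal

noncomputable section

/-- In a finite family `S` with sizes `c` in a preorder and values `a`, there is a subfamily `G`
such that each member of `S` lies below some member of `G` of at least half its value, and
the value more than doubles from each member of `G` to any strictly smaller one. -/
theorem exists_principal_subfamily {ι α : Type*} [Preorder α] (c : ι → α) (a : ι → ℝ≥0∞)
    (S : Finset ι) :
    ∃ G : Finset ι, G ⊆ S ∧
      (∀ Q ∈ S, ∃ P ∈ G, c Q ≤ c P ∧ a Q ≤ 2 * a P) ∧
      (∀ P ∈ G, ∀ P' ∈ G, c P < c P' → 2 * a P' < a P) := by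
  classical
  induction S using Finset.strongInduction with
  | H S ih =>
    rcases S.eq_empty_or_nonempty with rfl | hne
    · exact ⟨∅, by simp⟩
    obtain ⟨Q, hQ, hmin⟩ := S.exists_minimalFor c hne
    obtain ⟨G, hGS, hcover, hdouble⟩ := ih (S.erase Q) (Finset.erase_ssubset hQ)
    have hGS' : G ⊆ S := hGS.trans (Finset.erase_subset _ _)
    by_cases hex : ∃ P ∈ G, c Q < c P ∧ a Q ≤ 2 * a P
    · refine ⟨G, hGS', fun R hR => ?_, hdouble⟩
      by_cases hRQ : R = Q
      · obtain ⟨P, hP, hlt, ha⟩ := hex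
        exact ⟨P, hP, hRQ ▸ hlt.le, hRQ ▸ ha⟩
      · exact hcover R (Finset.mem_erase.2 ⟨hRQ, hR⟩)
    · push Not at hex
      refine ⟨insert Q G, Finset.insert_subset hQ hGS', fun R hR => ?_, fun P hP P' hP' hlt => ?_⟩
      · by_cases hRQ : R = Q
        · exact ⟨Q, Finset.mem_insert_self _ _, hRQ ▸ le_rfl,
            hRQ ▸ le_mul_of_one_le_left' one_le_two⟩
        · obtain ⟨P, hP, h⟩ := hcover R (Finset.mem_erase.2 ⟨hRQ, hR⟩)
          exact ⟨P, Finset.mem_insert_of_mem hP, h⟩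
      · rcases Finset.mem_insert.1 hP' with rfl | hP'G
        · have hPS : P ∈ S := Finset.insert_subset hQ hGS' hP
          exact absurd (hmin hPS hlt.le) hlt.not_ge
        · rcases Finset.mem_insert.1 hP with rfl | hPG
          · exact hex P' hP'G hlt
          · exact hdouble P hPG P' hP'G hlt

/-- **Existence of principal cubes.** -/
theorem stmt15 (d : ℕ) (σ : (Fin d → ℝ) → ℝ≥0∞) (hσ : Measurable σ)
    (hσfin : ∀ i : DIdx d, wMeasure σ (dcube i) ≠ ⊤)
    (f : (Fin d → ℝ) → ℝ≥0∞) (hf : Measurable f)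
    (hfint : (∫⁻ x, f x ∂(wMeasure σ)) ≠ ⊤)
    (S : Finset (DIdx d)) (hS : ∀ Q ∈ S, wMeasure σ (dcube Q) ≠ 0) :
    ∃ G : Finset (DIdx d), G ⊆ S ∧
      (∀ Q ∈ S, ∃ P ∈ G, dcube Q ⊆ dcube P ∧
        cavg (wMeasure σ) Q f ≤ 2 * cavg (wMeasure σ) P f) ∧
      (∀ P ∈ G, ∀ P' ∈ G, dcube P ⊂ dcube P' →
        2 * cavg (wMeasure σ) P' f < cavg (wMeasure σ) P f) := by
  exact exists_principal_subfamily dcube (fun Q => cavg (wMeasure σ) Q f) S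
end
end

section
/- (Full testing from the weak-type bound via duality.) Let 1 < p ≤ q < ∞, let τ = (τ_Q)_{Q∈𝒬} be nonnegative constants, and let σ, ω be weights on ℝ^d. Suppose there is 𝔑 < ∞ such that ω({x : T_τ(fσ)(x) > λ}) ≤ (𝔑 ‖f‖_{L^p(σ)} / λ)^q for all λ > 0 and all nonnegative f ∈ L^p(σ). Then for every dyadic cube Q with ω(Q) > 0, the full (untruncated) testing bound holds: ‖T_τ(1_Q ω)‖_{L^{p'}(σ)} ≤ C(p,q) · 𝔑 · ω(Q)^{1/q'}, where p' = p/(p−1), q' = q/(q−1). -/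
open MeasureTheory ENNReal

noncomputable section

lemma mem_dcube_floor {d : ℕ} (x : Fin d → ℝ) :
    x ∈ dcube ((0 : ℤ), fun j => ⌊x j⌋) := by
  intro j
  simp [Int.floor_le, Int.lt_floor_add_one]

lemma sigmaFinite_of_dcube {d : ℕ} {μ : Measure (Fin d → ℝ)}
    (h : ∀ i : DIdx d, μ (dcube i) ≠ ⊤) : SigmaFinite μ := by
  refine Measure.sigmaFinite_of_countable (S := Set.range (dcube (d := d)))
    (Set.countable_range _) ?_ ?_
  · rintro _ ⟨i, rfl⟩
    exact (h i).lt_top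
  · exact Set.eq_univ_of_forall fun x => ⟨_, ⟨_, rfl⟩, mem_dcube_floor x⟩

lemma measurable_Tdy {d : ℕ} (τ : DIdx d → ℝ≥0∞) (f : (Fin d → ℝ) → ℝ≥0∞) :
    Measurable (Tdy τ f) :=
  Measurable.tsum fun i => measurable_const.indicator (measurableSet_dcube i)

/-- Expansion of the bilinear form of the positive dyadic operator. -/
lemma lintegral_mul_Tdy {d : ℕ} (τ : DIdx d → ℝ≥0∞) (f : (Fin d → ℝ) → ℝ≥0∞)
    {g : (Fin d → ℝ) → ℝ≥0∞} (hg : Measurable g) :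
    ∫⁻ x, g x * Tdy τ f x =
      ∑' i : DIdx d, τ i * ((∫⁻ x in dcube i, f x) / volume (dcube i)) *
        ∫⁻ x in dcube i, g x := by
  simp_rw [Tdy, ← ENNReal.tsum_mul_left]
  rw [lintegral_tsum fun i =>
    (hg.fun_mul (measurable_const.indicator (measurableSet_dcube i))).aemeasurable]
  refine tsum_congr fun i => ?_
  rw [← lintegral_const_mul _ hg, ← lintegral_indicator (measurableSet_dcube i)]
  refine lintegral_congr fun x => ?_
  by_cases hx : x ∈ dcube i <;> simp [hx, lavg, cavg, mul_comm]

/-- The positive dyadic operator is self-adjoint with respect to Lebesgue measure. -/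
lemma lintegral_mul_Tdy_comm {d : ℕ} (τ : DIdx d → ℝ≥0∞) {f g : (Fin d → ℝ) → ℝ≥0∞}
    (hf : Measurable f) (hg : Measurable g) :
    ∫⁻ x, g x * Tdy τ f x = ∫⁻ x, f x * Tdy τ g x := by
  rw [lintegral_mul_Tdy τ f hg, lintegral_mul_Tdy τ g hf]
  refine tsum_congr fun i => ?_
  simp only [div_eq_mul_inv]
  ring

/-- The converse of Hölder's inequality for nonnegative functions. -/
lemma lpn_conj_le_of_forall_lintegral_mul_le {d : ℕ} {μ : Measure (Fin d → ℝ)} [SigmaFinite μ]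
    {p : ℝ} (hp : 1 < p) {g : (Fin d → ℝ) → ℝ≥0∞} (hg : Measurable g) {A : ℝ≥0∞}
    (h : ∀ f : (Fin d → ℝ) → ℝ≥0∞, Measurable f → lpn p μ f ≠ ⊤ →
      ∫⁻ x, f x * g x ∂μ ≤ A * lpn p μ f) :
    lpn (p / (p - 1)) μ g ≤ A := by
  have hp1 : 0 < p - 1 := by linarith
  have hp0 : 0 < p := by linarith
  set r := p / (p - 1) with hr
  have hr0 : 0 < r := by positivity
  have hr1 : 0 < r - 1 := by
    have : r - 1 = 1 / (p - 1) := by rw [hr]; field_simp; ring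
    rw [this]; positivity
  have hrp : (r - 1) * p = r := by rw [hr]; field_simp; ring
  have hadd : 1 / p + 1 / r = 1 := by rw [hr]; field_simp; ring
  let S := spanningSets μ
  let k : ℕ → (Fin d → ℝ) → ℝ≥0∞ := fun n => (S n).indicator fun x => min (g x) n
  have hSm : ∀ n, MeasurableSet (S n) := measurableSet_spanningSets μ
  have hkm : ∀ n, Measurable (k n) := fun n =>
    (hg.min measurable_const).indicator (hSm n)
  have hkg : ∀ n x, k n x ≤ g x := fun n x =>
    (Set.indicator_le_self _ _ x).trans (min_le_left _ _)
  have hbound : ∀ n, ∫⁻ x, k n x ^ r ∂μ ≤ A ^ r := by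
    intro n
    set I := ∫⁻ x, k n x ^ r ∂μ with hI
    have hIfin : I ≠ ⊤ := by
      have hle : I ≤ ∫⁻ x, (S n).indicator (fun _ => (n : ℝ≥0∞) ^ r) x ∂μ := by
        refine lintegral_mono fun x => ?_
        by_cases hx : x ∈ S n
        · simpa [k, hx] using ENNReal.rpow_le_rpow (min_le_right (g x) n) hr0.le
        · simp [k, hx, hr0]
      refine ne_top_of_le_ne_top ?_ hle
      rw [lintegral_indicator_const (hSm n)]
      exact ENNReal.mul_ne_top (ENNReal.rpow_ne_top_of_nonneg hr0.le (by simp))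
        (measure_spanningSets_lt_top μ n).ne
    have hnorm : lpn p μ (fun x => k n x ^ (r - 1)) = I ^ (1 / p) := by
      simp only [lpn, ← ENNReal.rpow_mul, hrp, hI]
    have hle : I ≤ A * I ^ (1 / p) := by
      have := h (fun x => k n x ^ (r - 1)) ((hkm n).pow_const _)
        (by rw [hnorm]; exact ENNReal.rpow_ne_top_of_nonneg (by positivity) hIfin)
      rw [hnorm] at this
      refine le_trans (lintegral_mono fun x => ?_) this
      calc k n x ^ r = k n x ^ (r - 1) * k n x ^ (1 : ℝ) := by
            rw [← ENNReal.rpow_add_of_nonneg _ _ hr1.le zero_le_one]; ring_nf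
        _ ≤ k n x ^ (r - 1) * g x := by
            rw [ENNReal.rpow_one]; gcongr; exact hkg n x
    rcases eq_or_ne I 0 with h0 | h0
    · simp [h0]
    have hpne : I ^ (1 / p) ≠ 0 := by simp [ENNReal.rpow_eq_zero_iff, h0, hIfin]
    have hpfin : I ^ (1 / p) ≠ ⊤ := ENNReal.rpow_ne_top_of_nonneg (by positivity) hIfin
    have hroot : I ^ (1 / r) ≤ A := by
      have hsplit : I = I ^ (1 / r) * I ^ (1 / p) := by
        rw [← ENNReal.rpow_add _ _ h0 hIfin, add_comm, hadd, ENNReal.rpow_one]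
      exact (ENNReal.mul_le_mul_iff_left hpne hpfin).1 (hsplit.symm.trans_le hle)
    simpa [← ENNReal.rpow_mul, hr0.ne'] using ENNReal.rpow_le_rpow hroot hr0.le
  have hlim : Filter.Tendsto (fun n => ∫⁻ x, k n x ^ r ∂μ) Filter.atTop
      (nhds (∫⁻ x, g x ^ r ∂μ)) := by
    refine lintegral_tendsto_of_tendsto_of_monotone (fun n => ((hkm n).pow_const _).aemeasurable)
      (Filter.Eventually.of_forall fun x m n hmn => ?_) (Filter.Eventually.of_forall fun x => ?_)
    · refine ENNReal.rpow_le_rpow ?_ hr0.le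
      refine (Set.indicator_le_indicator_of_subset (monotone_spanningSets μ hmn)
        (fun _ => zero_le) x).trans (Set.indicator_le_indicator ?_)
      exact min_le_min_left _ (by exact_mod_cast hmn)
    · refine (ENNReal.continuous_rpow_const.tendsto _).comp ?_
      have hmin : Filter.Tendsto (fun n : ℕ => min (g x) n) Filter.atTop (nhds (g x)) := by
        simpa using tendsto_const_nhds.min ENNReal.tendsto_nat_nhds_top
      refine hmin.congr' ?_
      have hx : x ∈ ⋃ n, S n := by simp [S, iUnion_spanningSets]
      obtain ⟨m, hm⟩ := Set.mem_iUnion.1 hx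
      filter_upwards [Filter.eventually_ge_atTop m] with n hn
      simp [k, monotone_spanningSets μ hn hm, S]
  have := ENNReal.rpow_le_rpow (le_of_tendsto' hlim hbound) (z := 1 / r) (by positivity)
  rwa [← ENNReal.rpow_mul, mul_one_div_cancel hr0.ne', ENNReal.rpow_one] at this

/-- A dyadic layer-cake bound. -/
lemma le_add_tsum_two_pow_indicator {t : ℝ≥0∞} (ht0 : t ≠ 0) (a : ℝ≥0∞) :
    a ≤ t + ∑' k : ℕ, if 2 ^ k * t < a then 2 ^ (k + 1) * t else 0 := by
  by_cases hle : ∃ k : ℕ, a ≤ 2 ^ k * t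
  · classical
    have hspec := Nat.find_spec hle
    rcases hk : Nat.find hle with _ | k
    · rw [hk] at hspec
      exact le_add_right (by simpa using hspec)
    · rw [hk] at hspec
      have hlt : 2 ^ k * t < a := not_le.1 (Nat.find_min hle (by omega))
      refine le_add_left (le_trans ?_ (ENNReal.le_tsum k))
      simpa [hlt] using hspec
  · push Not at hle
    have : ∑' k : ℕ, (if 2 ^ k * t < a then 2 ^ (k + 1) * t else 0) = ⊤ := by
      refine top_le_iff.1 ?_
      rw [← ENNReal.tsum_const_eq_top_of_ne_zero (α := ℕ) ht0]
      refine ENNReal.tsum_le_tsum fun k => ?_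
      rw [if_pos (hle k)]
      exact le_mul_of_one_le_left zero_le (one_le_pow₀ one_le_two)
    simp [this]

/-- The constant in Kolmogorov's inequality `setLIntegral_le_of_weakType`. -/
def kolmogorovConst (q : ℝ) : ℝ≥0∞ := 1 + ∑' k : ℕ, 2 * ((2 : ℝ≥0∞) ^ (1 - q)) ^ k

lemma kolmogorovConst_lt_top {q : ℝ} (hq : 1 < q) : kolmogorovConst q < ⊤ := by
  have hlt : (2 : ℝ≥0∞) ^ (1 - q) < 1 :=
    ENNReal.rpow_lt_one_of_one_lt_of_neg (by norm_num) (by linarith)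
  rw [kolmogorovConst, ENNReal.tsum_mul_left, ENNReal.tsum_geometric]
  refine ENNReal.add_lt_top.2 ⟨by simp, ENNReal.mul_lt_top (by simp) ?_⟩
  exact ENNReal.inv_lt_top.2 (tsub_pos_of_lt hlt)

/-- Kolmogorov's inequality: a weak-type bound controls the integral over a set of finite measure. -/
lemma setLIntegral_le_of_weakType {α : Type*} [MeasurableSpace α] {μ : Measure α} {q : ℝ}
    (hq : 1 < q) {F : α → ℝ≥0∞} (hF : Measurable F) {E : Set α}
    (hE0 : μ E ≠ 0) (hE : μ E ≠ ⊤) {M : ℝ≥0∞} (hM : M ≠ ⊤)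
    (h : ∀ lam : ℝ≥0∞, 0 < lam → μ {x | lam < F x} ≤ (M / lam) ^ q) :
    ∫⁻ x in E, F x ∂μ ≤ kolmogorovConst q * M * μ E ^ (1 / (q / (q - 1))) := by
  have hq0 : 0 < q := by linarith
  have hq1 : 0 < q - 1 := by linarith
  have hCtop := (kolmogorovConst_lt_top hq).ne
  have key : ∀ M' : ℝ≥0∞, M < M' → M' ≠ ⊤ →
      ∫⁻ x in E, F x ∂μ ≤ kolmogorovConst q * M' * μ E ^ (1 / (q / (q - 1))) := by
    intro M' hMM' hM'
    have hM'0 : M' ≠ 0 := (bot_lt_of_lt hMM').ne'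
    set t := M' * μ E ^ (-(1 / q)) with ht
    have hWne : μ E ^ (-(1 / q)) ≠ 0 := by simp [ENNReal.rpow_eq_zero_iff, hE0, hE]
    have ht0 : t ≠ 0 := mul_ne_zero hM'0 hWne
    have htW : (M' / t) ^ q = μ E := by
      rw [ht, ENNReal.rpow_neg, ← div_eq_mul_inv, ENNReal.div_div_cancel hM'0 hM',
        ← ENNReal.rpow_mul, one_div_mul_cancel hq0.ne', ENNReal.rpow_one]
    have hlevel : ∀ k : ℕ, 2 ^ (k + 1) * t * μ {x | 2 ^ k * t < F x} ≤
        t * μ E * (2 * ((2 : ℝ≥0∞) ^ (1 - q)) ^ k) := by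
      intro k
      have h2 : (2 : ℝ≥0∞) ^ k ≠ 0 := by simp
      have h2' : (2 : ℝ≥0∞) ^ k ≠ ⊤ := by simp
      have hmeas : μ {x | 2 ^ k * t < F x} ≤ μ E * ((2 : ℝ≥0∞) ^ (-q)) ^ k := by
        refine (h _ (pos_iff_ne_zero.2 (mul_ne_zero h2 ht0))).trans ?_
        calc (M / (2 ^ k * t)) ^ q ≤ (M' / (2 ^ k * t)) ^ q := by gcongr
          _ = (M' / t * (2 ^ k)⁻¹) ^ q := by
              rw [div_eq_mul_inv, ENNReal.mul_inv (.inl h2) (.inl h2'), div_eq_mul_inv]; ring_nf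
          _ = μ E * ((2 : ℝ≥0∞) ^ (-q)) ^ k := by
              rw [ENNReal.mul_rpow_of_nonneg _ _ hq0.le, htW, ENNReal.inv_rpow, ← ENNReal.rpow_neg]
              congr 1
              rw [← ENNReal.rpow_natCast, ← ENNReal.rpow_natCast, ← ENNReal.rpow_mul,
                ← ENNReal.rpow_mul, mul_comm]
      refine (mul_le_mul_right hmeas _).trans_eq ?_
      rw [sub_eq_add_neg, ENNReal.rpow_add _ _ (by simp) (by simp), ENNReal.rpow_one, mul_pow]
      ring
    calc ∫⁻ x in E, F x ∂μ
        ≤ ∫⁻ x in E, (t + ∑' k : ℕ, {x | 2 ^ k * t < F x}.indicator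
            (fun _ => 2 ^ (k + 1) * t) x) ∂μ :=
          lintegral_mono fun x => by
            simpa [Set.indicator_apply] using le_add_tsum_two_pow_indicator ht0 (F x)
      _ ≤ t * μ E + ∑' k : ℕ, t * μ E * (2 * ((2 : ℝ≥0∞) ^ (1 - q)) ^ k) := by
          have hms : ∀ k : ℕ, MeasurableSet {x | 2 ^ k * t < F x} := fun k =>
            measurableSet_lt measurable_const hF
          rw [lintegral_add_left measurable_const, setLIntegral_const,
            lintegral_tsum fun k => (measurable_const.indicator (hms k)).aemeasurable]
          gcongr with k
          rw [lintegral_indicator_const (hms k)]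
          exact (mul_le_mul_right (Measure.restrict_apply_le _ _) _).trans (hlevel k)
      _ = kolmogorovConst q * M' * μ E ^ (1 / (q / (q - 1))) := by
          have hexp : 1 / (q / (q - 1)) = -(1 / q) + 1 := by field_simp; ring
          rw [ENNReal.tsum_mul_left, hexp, ENNReal.rpow_add _ _ hE0 hE, ENNReal.rpow_one,
            kolmogorovConst, ht]
          ring
  have hWtop : μ E ^ (1 / (q / (q - 1))) ≠ ⊤ :=
    ENNReal.rpow_ne_top_of_nonneg (by positivity) hE
  have hlim : Filter.Tendsto
      (fun M' => kolmogorovConst q * M' * μ E ^ (1 / (q / (q - 1))))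
      (nhdsWithin M (Set.Ioi M)) (nhds (kolmogorovConst q * M * μ E ^ (1 / (q / (q - 1))))) := by
    refine Filter.Tendsto.mono_left ?_ nhdsWithin_le_nhds
    exact ENNReal.Tendsto.mul_const (ENNReal.Tendsto.const_mul Filter.tendsto_id (.inr hCtop))
      (.inr hWtop)
  have : (nhdsWithin M (Set.Ioi M)).NeBot := nhdsGT_neBot_of_exists_gt ⟨⊤, hM.lt_top⟩
  refine ge_of_tendsto hlim ?_
  filter_upwards [Ioo_mem_nhdsGT hM.lt_top] with K hK
  exact key K hK.1 hK.2.ne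

/-- **Full testing from the weak-type bound via duality.** -/
theorem stmt19 (d : ℕ) (p q : ℝ) (hp : 1 < p) (hpq : p ≤ q) :
    ∃ C : ℝ≥0∞, 0 < C ∧ C < ⊤ ∧
      ∀ (τ : DIdx d → ℝ≥0∞) (σ ω : (Fin d → ℝ) → ℝ≥0∞),
        Measurable σ → Measurable ω →
        (∀ i : DIdx d, wMeasure σ (dcube i) ≠ ⊤) →
        (∀ i : DIdx d, wMeasure ω (dcube i) ≠ ⊤) →
        ∀ N : ℝ≥0∞, N ≠ ⊤ →
          (∀ f : (Fin d → ℝ) → ℝ≥0∞, Measurable f → lpn p (wMeasure σ) f ≠ ⊤ →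
            ∀ lam : ℝ≥0∞, 0 < lam →
              wMeasure ω {x | lam < Tdy τ (fun y => f y * σ y) x} ≤
                (N * lpn p (wMeasure σ) f / lam) ^ q) →
          ∀ Q : DIdx d, wMeasure ω (dcube Q) ≠ 0 →
            lpn (p / (p - 1)) (wMeasure σ) (Tdy τ ((dcube Q).indicator ω)) ≤
              C * N * wMeasure ω (dcube Q) ^ (1 / (q / (q - 1))) := by
  have hq : 1 < q := hp.trans_le hpq
  refine ⟨kolmogorovConst q, lt_of_lt_of_le one_pos le_self_add, kolmogorovConst_lt_top hq, ?_⟩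
  intro τ σ ω hσ hω hσfin hωfin N hN hweak Q hQ
  have : SigmaFinite (wMeasure σ) := sigmaFinite_of_dcube hσfin
  refine lpn_conj_le_of_forall_lintegral_mul_le hp (measurable_Tdy τ _) fun f hf hfin => ?_
  have hQm := measurableSet_dcube Q
  have hdual : ∫⁻ x, f x * Tdy τ ((dcube Q).indicator ω) x ∂(wMeasure σ) =
      ∫⁻ x in dcube Q, Tdy τ (fun y => f y * σ y) x ∂(wMeasure ω) := by
    rw [wMeasure, lintegral_withDensity_eq_lintegral_mul _ hσ (hf.fun_mul (measurable_Tdy τ _)),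
      wMeasure, restrict_withDensity hQm,
      lintegral_withDensity_eq_lintegral_mul _ hω (measurable_Tdy τ _),
      ← lintegral_indicator hQm]
    have hcomm := lintegral_mul_Tdy_comm τ (hω.indicator hQm) (hf.mul hσ)
    refine Eq.trans (lintegral_congr fun x => ?_) (hcomm.trans (lintegral_congr fun x => ?_))
    · simp only [Pi.mul_apply]; ring
    · by_cases hx : x ∈ dcube Q
      · simp only [Set.indicator_of_mem hx, Pi.mul_apply]
        rfl
      · simp [hx]
  rw [hdual]
  refine (setLIntegral_le_of_weakType hq (measurable_Tdy τ _) hQ (hωfin Q)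
    (ENNReal.mul_ne_top hN hfin) (hweak f hf hfin)).trans_eq ?_
  ring
end
end
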